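/- arXiv:2206.09527 — 3 statements merged into one kernel-verified Lean document; each statement's English description precedes it below -/
import Mathlib

section
/- Let q ≥ 2 and K ≥ 2 be integers. There exists a ReQU network of architecture (1, 4(K+2q−1)+K, 4K+8q, 4K+8q, 4K+8q, K+2q) with 4 hidden layers, all weights in [−1,1], and at most 72(K+2q) nonzero weights, whose output at every x ∈ [0,1) equals the vector ( x, K, B_1^{2,K}(x), B_2^{2,K}(x), …, B_{K+2q−2}^{2,K}(x) ). -/
open scoped BigOperators Classical

noncomputable def requ (t : ℝ) : ℝ := (max t 0) ^ 2

structure ReQUNet where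
  L : ℕ
  arch : ℕ → ℕ
  W : ℕ → ℕ → ℕ → ℝ
  v : ℕ → ℕ → ℝ

namespace ReQUNet

noncomputable def hidden (N : ReQUNet) (x : ℕ → ℝ) : ℕ → ℕ → ℝ
  | 0, j => ∑ k ∈ Finset.range (N.arch 0), N.W 0 j k * x k
  | i + 1, j =>
      ∑ k ∈ Finset.range (N.arch (i + 1)),
        N.W (i + 1) j k * requ (N.hidden x i k - N.v (i + 1) k)

noncomputable def eval (N : ReQUNet) (x : ℕ → ℝ) : ℕ → ℝ := N.hidden x N.L

noncomputable def evalVec (N : ReQUNet) (d : ℕ) (x : Fin d → ℝ) : ℕ → ℝ :=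
  N.eval fun k => if h : k < d then x ⟨k, h⟩ else 0

def width (N : ReQUNet) : ℕ := (Finset.range (N.L + 2)).sup N.arch

def weightsIn (N : ReQUNet) (s : Set ℝ) : Prop :=
  (∀ i ≤ N.L, ∀ j < N.arch (i + 1), ∀ k < N.arch i, N.W i j k ∈ s) ∧
  ∀ i, 1 ≤ i → i ≤ N.L → ∀ j < N.arch i, N.v i j ∈ s

noncomputable def numNonzero (N : ReQUNet) : ℕ :=
  (∑ i ∈ Finset.range (N.L + 1),
    ((Finset.range (N.arch (i + 1)) ×ˢ Finset.range (N.arch i)).filter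
      fun p => N.W i p.1 p.2 ≠ 0).card) +
  ∑ i ∈ Finset.Icc 1 N.L,
    ((Finset.range (N.arch i)).filter fun j => N.v i j ≠ 0).card

end ReQUNet

noncomputable def pderiv1 {d : ℕ} (i : Fin d) (g : (Fin d → ℝ) → ℝ) : (Fin d → ℝ) → ℝ :=
  fun x => fderiv ℝ g x (Pi.single i 1)

noncomputable def mderiv {d : ℕ} (γ : Fin d → ℕ) (g : (Fin d → ℝ) → ℝ) : (Fin d → ℝ) → ℝ :=
  (List.finRange d).foldr (fun i h => (pderiv1 i)^[γ i] h) g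

noncomputable def eucDist {d : ℕ} (x y : Fin d → ℝ) : ℝ :=
  Real.sqrt (∑ i, (x i - y i) ^ 2)

def cube (d : ℕ) : Set (Fin d → ℝ) := Set.Icc 0 1

def cubeHO (d : ℕ) : Set (Fin d → ℝ) := Set.Ico 0 1

def HolderNormLeOn {d : ℕ} (Ω : Set (Fin d → ℝ)) : ℕ → ((Fin d → ℝ) → ℝ) → ℝ → Prop
  | 0, g, E => ∀ x ∈ Ω, |g x| ≤ E
  | m + 1, g, E =>
      (∀ γ : Fin d → ℕ, (∑ i, γ i) ≤ m → ∀ x ∈ Ω, |mderiv γ g x| ≤ E) ∧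
      ∀ γ : Fin d → ℕ, (∑ i, γ i) = m → ∀ x ∈ Ω, ∀ y ∈ Ω, x ≠ y →
        |mderiv γ g x - mderiv γ g y| ≤ E * min 1 (eucDist x y)

def VHolderNormLe {d : ℕ} (p ℓ : ℕ) (f : (Fin d → ℝ) → Fin p → ℝ) (E : ℝ) : Prop :=
  ∀ i : Fin p, HolderNormLeOn (cube d) ℓ (fun x => f x i) E

noncomputable def lfloor (β : ℝ) : ℕ := ⌈β⌉₊ - 1

def MemHolderBall {d : ℕ} (p : ℕ) (β H : ℝ) (f : (Fin d → ℝ) → Fin p → ℝ) : Prop :=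
  (∀ i : Fin p, ContDiff ℝ (lfloor β : ℕ∞) fun x => f x i) ∧
  (∀ i : Fin p, ∀ γ : Fin d → ℕ, (∑ j, γ j) ≤ lfloor β →
      ∀ x ∈ cube d, |mderiv γ (fun y => f y i) x| ≤ H) ∧
  ∀ i : Fin p, ∀ γ : Fin d → ℕ, (∑ j, γ j) = lfloor β →
      ∀ x ∈ cube d, ∀ y ∈ cube d, x ≠ y →
        |mderiv γ (fun z => f z i) x - mderiv γ (fun z => f z i) y| ≤
          H * min 1 (eucDist x y) ^ (β - (lfloor β : ℝ))

def MemHolderBall1 {d : ℕ} (β H : ℝ) (f : (Fin d → ℝ) → ℝ) : Prop :=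
  (ContDiff ℝ (lfloor β : ℕ∞) f) ∧
  (∀ γ : Fin d → ℕ, (∑ j, γ j) ≤ lfloor β → ∀ x ∈ cube d, |mderiv γ f x| ≤ H) ∧
  ∀ γ : Fin d → ℕ, (∑ j, γ j) = lfloor β →
      ∀ x ∈ cube d, ∀ y ∈ cube d, x ≠ y →
        |mderiv γ f x - mderiv γ f y| ≤ H * min 1 (eucDist x y) ^ (β - (lfloor β : ℝ))

noncomputable def loglog2 (H : ℝ) : ℝ := if H ≤ 2 then 0 else Real.logb 2 (Real.logb 2 H)

noncomputable def knot (q K j : ℕ) : ℝ :=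
  if j ≤ q + 1 then 0 else if j ≤ q + K then ((j - (q + 1) : ℕ) : ℝ) / K else 1

noncomputable def Bspl (q K : ℕ) : ℕ → ℕ → ℝ → ℝ
  | 0, j, x =>
      if knot q K j < knot q K (j + 1) ∧ knot q K j ≤ x ∧ x < knot q K (j + 1) then
        1 / (knot q K (j + 1) - knot q K j)
      else 0
  | m + 1, j, x =>
      if knot q K j < knot q K (j + m + 2) ∧ knot q K j ≤ x ∧ x < knot q K (j + m + 2) then
        ((x - knot q K j) * Bspl q K m j x
            + (knot q K (j + m + 2) - x) * Bspl q K m (j + 1) x) /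
          (knot q K (j + m + 2) - knot q K j)
      else 0

noncomputable def Nspl (q K m j : ℕ) (x : ℝ) : ℝ :=
  (knot q K (j + m + 1) - knot q K j) * Bspl q K m j x

def QRanalytic {d : ℕ} (p : ℕ) (Q R : ℝ) (f : (Fin d → ℝ) → Fin p → ℝ) : Prop :=
  (∀ i : Fin p, ContDiff ℝ (⊤ : ℕ∞) fun x => f x i) ∧
  ∀ s : ℕ, VHolderNormLe p s f (Q * ((R : ℝ) ^ s)⁻¹ * (Nat.factorial s : ℝ))

def archSpec (q K i : ℕ) : ℕ :=
  if i = 0 then 1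
  else if i = 1 then 4 * (K + 2 * q - 1) + K
  else if i ≤ 4 then 4 * K + 8 * q
  else if i ≤ 4 + 2 * (q - 2) then
    (if (i - 5) % 2 = 0 then 12 * (K + 2 * q - (3 + (i - 5) / 2)) + 12
      else 8 * (K + 2 * q - (3 + (i - 5) / 2)) + 8)
  else K + q + 2

/-- The weight row whose nonzero entries are the list `l`, placed at columns `b, b + 1, …`. -/
noncomputable def bandRow (b : ℕ) (l : List ℝ) (k : ℕ) : ℝ :=
  if b ≤ k then l.getD (k - b) 0 else 0

theorem bandRow_eq_zero {b : ℕ} {l : List ℝ} {k : ℕ} (h : k < b ∨ b + l.length ≤ k) :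
    bandRow b l k = 0 := by
  unfold bandRow
  split_ifs with hb
  · rw [List.getD_eq_default]
    omega
  · rfl

theorem bandRow_mem {b : ℕ} {l : List ℝ} {k : ℕ} (h : ∀ a ∈ l, a ∈ Set.Icc (-1 : ℝ) 1) :
    bandRow b l k ∈ Set.Icc (-1 : ℝ) 1 := by
  unfold bandRow
  split_ifs with hb
  · by_cases hk : k - b < l.length
    · rw [List.getD_eq_getElem _ _ hk]
      exact h _ (List.getElem_mem hk)
    · rw [List.getD_eq_default _ _ (not_lt.mp hk)]
      norm_num
  · norm_num

theorem sum_bandRow {b : ℕ} {l : List ℝ} {n : ℕ} (f : ℕ → ℝ) (h : b + l.length ≤ n) :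
    ∑ k ∈ Finset.range n, bandRow b l k * f k
      = ∑ d ∈ Finset.range l.length, l.getD d 0 * f (b + d) := by
  have h1 : ∑ k ∈ Finset.range n, bandRow b l k * f k
      = ∑ k ∈ Finset.Ico b (b + l.length), bandRow b l k * f k := by
    symm
    apply Finset.sum_subset
    · intro k hk
      simp only [Finset.mem_Ico, Finset.mem_range] at *
      omega
    · intro k _ hk
      rw [bandRow_eq_zero, zero_mul]
      simp only [Finset.mem_Ico] at hk
      omega
  rw [h1, Finset.sum_Ico_eq_sum_range]
  simp [bandRow]

theorem card_bandRow_le (b : ℕ → ℕ) (l : ℕ → List ℝ) (n m : ℕ) :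
    ((Finset.range n ×ˢ Finset.range m).filter
      fun p => bandRow (b p.1) (l p.1) p.2 ≠ 0).card
      ≤ ∑ j ∈ Finset.range n, (l j).length := by
  rw [Finset.card_filter, Finset.sum_product]
  refine Finset.sum_le_sum fun j _ => ?_
  rw [← Finset.card_filter]
  calc _ ≤ (Finset.Ico (b j) (b j + (l j).length)).card := by
        apply Finset.card_le_card
        intro k hk
        simp only [Finset.mem_filter] at hk
        by_contra hc
        apply hk.2
        apply bandRow_eq_zero
        simp only [Finset.mem_Ico] at hc
        omega
    _ = _ := by simp

theorem sum_range_le_mul {f : ℕ → ℕ} {m c : ℕ} (n : ℕ) (h : ∀ j, f j ≤ c)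
    (h0 : ∀ j, m ≤ j → f j = 0) : ∑ j ∈ Finset.range n, f j ≤ m * c := by
  calc ∑ j ∈ Finset.range n, f j ≤ ∑ j ∈ Finset.range n, if j < m then c else 0 := by
        refine Finset.sum_le_sum fun j _ => ?_
        split_ifs with hj
        · exact h j
        · exact (h0 j (not_lt.mp hj)).le
    _ = ((Finset.range n).filter (· < m)).card * c := by
        rw [← Finset.sum_filter, Finset.sum_const, smul_eq_mul]
    _ ≤ m * c := by
        gcongr
        calc _ ≤ (Finset.range m).card := by
              apply Finset.card_le_card
              intro j hj
              simpa using (Finset.mem_filter.mp hj).2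
          _ = m := Finset.card_range m

theorem card_ne_zero_le {f : ℕ → ℝ} {m : ℕ} (n : ℕ) (h : ∀ j, m ≤ j → f j = 0) :
    ((Finset.range n).filter fun j => f j ≠ 0).card ≤ m := by
  calc _ ≤ (Finset.range m).card := by
        apply Finset.card_le_card
        intro j hj
        by_contra hc
        exact (Finset.mem_filter.mp hj).2 (h j (by simpa using hc))
    _ = m := Finset.card_range m

theorem requ_of_nonneg {t : ℝ} (h : 0 ≤ t) : requ t = t ^ 2 := by
  rw [requ, max_eq_left h]

theorem requ_of_nonpos {t : ℝ} (h : t ≤ 0) : requ t = 0 := by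
  simp [requ, max_eq_right h]

theorem requ_mul {r : ℝ} (hr : 0 ≤ r) (t : ℝ) : requ (r * t) = r ^ 2 * requ t := by
  rcases le_total 0 t with h | h
  · rw [requ_of_nonneg h, requ_of_nonneg (mul_nonneg hr h), mul_pow]
  · rw [requ_of_nonpos h, requ_of_nonpos (mul_nonpos_of_nonneg_of_nonpos hr h), mul_zero]

/-- The normalized degree-zero B-spline with knots `a, b`. -/
noncomputable def bsplZero (a b x : ℝ) : ℝ :=
  if a < b ∧ a ≤ x ∧ x < b then 1 / (b - a) else 0

/-- The normalized linear B-spline with knots `a, b, c`. -/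
noncomputable def bsplOne (a b c x : ℝ) : ℝ :=
  if a < c ∧ a ≤ x ∧ x < c then
    ((x - a) * bsplZero a b x + (c - x) * bsplZero b c x) / (c - a)
  else 0

/-- The normalized quadratic B-spline with knots `a, b, c, d`. -/
noncomputable def bsplTwo (a b c d x : ℝ) : ℝ :=
  if a < d ∧ a ≤ x ∧ x < d then
    ((x - a) * bsplOne a b c x + (d - x) * bsplOne b c d x) / (d - a)
  else 0

theorem Bspl_two (q K j : ℕ) (x : ℝ) :
    Bspl q K 2 j x
      = bsplTwo (knot q K j) (knot q K (j + 1)) (knot q K (j + 2)) (knot q K (j + 3)) x := by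
  simp only [Bspl, bsplTwo, bsplOne, bsplZero]

section Scaling

variable {k : ℝ}

theorem bsplZero_div (hk : 0 < k) (a b y : ℝ) :
    bsplZero (a / k) (b / k) (y / k) = k * bsplZero a b y := by
  simp only [bsplZero, div_lt_div_iff_of_pos_right hk, div_le_div_iff_of_pos_right hk]
  split_ifs with h
  · have : b - a ≠ 0 := (sub_pos.mpr h.1).ne'
    field_simp
  · simp

theorem bsplOne_div (hk : 0 < k) (a b c y : ℝ) :
    bsplOne (a / k) (b / k) (c / k) (y / k) = k * bsplOne a b c y := by
  simp only [bsplOne, bsplZero_div hk, div_lt_div_iff_of_pos_right hk,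
    div_le_div_iff_of_pos_right hk]
  split_ifs with h
  · have : c - a ≠ 0 := (sub_pos.mpr h.1).ne'
    field_simp
  · simp

theorem bsplTwo_div (hk : 0 < k) (a b c d y : ℝ) :
    bsplTwo (a / k) (b / k) (c / k) (d / k) (y / k) = k * bsplTwo a b c d y := by
  simp only [bsplTwo, bsplOne_div hk, div_lt_div_iff_of_pos_right hk,
    div_le_div_iff_of_pos_right hk]
  split_ifs with h
  · have : d - a ≠ 0 := (sub_pos.mpr h.1).ne'
    field_simp
  · simp

end Scaling

theorem bsplTwo_uniform (a y : ℝ) :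
    bsplTwo a (a + 1) (a + 2) (a + 3) y
      = 1 / 6 * requ (y - a) - 1 / 2 * requ (y - (a + 1)) + 1 / 2 * requ (y - (a + 2))
        - 1 / 6 * requ (y - (a + 3)) := by
  obtain ⟨t, rfl⟩ : ∃ t, y = a + t := ⟨y - a, by ring⟩
  simp only [bsplTwo, bsplOne, bsplZero, requ, max_def, add_sub_add_left_eq_sub,
    add_sub_cancel_left, add_le_add_iff_left, add_lt_add_iff_left, lt_add_iff_pos_right,
    le_add_iff_nonneg_right]
  norm_num only
  split_ifs <;> first | (exfalso; grind) | nlinarith | (obtain rfl : t = 3 := by grind); norm_num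

theorem bsplTwo_left_triple {y : ℝ} (hy : 0 ≤ y) : bsplTwo 0 0 0 1 y = requ (1 - y) := by
  simp only [bsplTwo, bsplOne, bsplZero, requ, max_def]
  norm_num only
  split_ifs <;> first | (exfalso; grind) | nlinarith

theorem bsplTwo_left_double {y : ℝ} (hy : 0 ≤ y) :
    bsplTwo 0 0 1 2 y = 1 / 4 * requ (2 - y) - requ (1 - y) := by
  simp only [bsplTwo, bsplOne, bsplZero, requ, max_def]
  norm_num only
  split_ifs <;> first | (exfalso; grind) | nlinarith

theorem bsplTwo_right_double {a y : ℝ} (hy : y < a + 2) :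
    bsplTwo a (a + 1) (a + 2) (a + 2) y = 1 / 4 * requ (y - a) - requ (y - (a + 1)) := by
  obtain ⟨t, rfl⟩ : ∃ t, y = a + t := ⟨y - a, by ring⟩
  simp only [bsplTwo, bsplOne, bsplZero, requ, max_def, add_sub_add_left_eq_sub,
    add_sub_cancel_left, add_le_add_iff_left, add_lt_add_iff_left, lt_add_iff_pos_right,
    le_add_iff_nonneg_right] at *
  norm_num only
  split_ifs <;> first | (exfalso; grind) | nlinarith

theorem bsplTwo_right_triple {a y : ℝ} (hy : y < a + 1) :
    bsplTwo a (a + 1) (a + 1) (a + 1) y = requ (y - a) := by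
  obtain ⟨t, rfl⟩ : ∃ t, y = a + t := ⟨y - a, by ring⟩
  simp only [bsplTwo, bsplOne, bsplZero, requ, max_def, add_sub_add_left_eq_sub,
    add_sub_cancel_left, add_le_add_iff_left, add_lt_add_iff_left, lt_add_iff_pos_right,
    le_add_iff_nonneg_right] at *
  norm_num only
  split_ifs <;> first | (exfalso; grind) | nlinarith

namespace SplineNet

/-- Weights from the inputs into the first hidden layer. -/
noncomputable def weightIn (j : ℕ) : List ℝ := if j ≤ 1 then [1] else []

/-- Biases of the first hidden layer, whose outputs are `x ^ 2`, `(x + 1) ^ 2` and `K` ones. -/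
noncomputable def biasOne (K j : ℕ) : ℝ := if 1 ≤ j ∧ j < K + 2 then -1 else 0

/-- Weights into the second hidden layer, with preactivations `K + x`, `K`, `x`, `x + 1`. -/
noncomputable def weightTwo (K : ℕ) : ℕ → List ℝ
  | 0 => -1 / 2 :: 1 / 2 :: List.replicate K 1
  | 1 => 0 :: 0 :: List.replicate K 1
  | 2 => [-1 / 2, 1 / 2]
  | 3 => [-1 / 2, 1 / 2]
  | _ => []

/-- Biases of the second hidden layer. -/
noncomputable def biasTwo : ℕ → ℝ
  | 0 => 1 / 2
  | 2 => 1 / 2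
  | 3 => -1 / 2
  | _ => 0

/-- Weights into the third hidden layer, with preactivations
`K + r x`, `K`, `r x`, `x`, `x + 1`, `K`, where `r` is the square root of `K`. -/
noncomputable def weightThree (r : ℝ) : ℕ → List ℝ
  | 0 => [1 / (2 * r), 1 / r ^ 2 - 1 / (2 * r), -1 / (2 * r)]
  | 1 => [0, 1 / r ^ 2]
  | 2 => [1 / (2 * r), -1 / (2 * r), -1 / (2 * r)]
  | 3 => [0, 0, -1 / 2, 1 / 2]
  | 4 => [0, 0, -1 / 2, 1 / 2]
  | 5 => [0, 1 / r ^ 2]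
  | _ => []

/-- Biases of the third hidden layer. -/
noncomputable def biasThree : ℕ → ℝ
  | 3 => 1 / 2
  | 4 => -1 / 2
  | _ => 0

/-- Weights into the fourth hidden layer, with preactivations `x`, `x + 1`, `1`, `r`,
`r (1 - K x)`, `r (2 - K x)` and `r (K x - i)` for `i ≤ K`. -/
noncomputable def weightFour (K : ℕ) (r : ℝ) : ℕ → List ℝ
  | 0 => [0, 0, 0, -1 / 2, 1 / 2]
  | 1 => [0, 0, 0, -1 / 2, 1 / 2]
  | 2 => []
  | 3 => [0, 1 / r ^ 3]
  | 4 => [-1 / 2, 1 / 2, 1 / 2, 0, 0, 1 / r ^ 3]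
  | 5 => [-1 / 2, 1 / 2, 1 / 2, 0, 0, 2 / r ^ 3]
  | i + 6 => if i ≤ K then [1 / 2, -1 / 2, -1 / 2, 0, 0, -(i / r ^ 3)] else []

/-- Biases of the fourth hidden layer. -/
noncomputable def biasFour : ℕ → ℝ
  | 0 => 1 / 2
  | 1 => -1 / 2
  | 2 => -1
  | _ => 0

/-- First column of the nonzero band in a row of the output weights. -/
def baseOut (q K s : ℕ) : ℕ :=
  if s = 0 then 0
  else if s = 1 then 3
  else if s = q ∨ s = q + 1 then 4
  else if q + 2 ≤ s ∧ s ≤ q + K + 1 then 6 + (s - (q + 2))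
  else 0

/-- Nonzero band in a row of the output weights. -/
noncomputable def weightOut (q K s : ℕ) : List ℝ :=
  if s = 0 then [-1 / 2, 1 / 2, -1 / 2]
  else if s = 1 then [1]
  else if s = q then [1]
  else if s = q + 1 then [-1, 1 / 4]
  else if q + 2 ≤ s ∧ s < q + K then [1 / 6, -1 / 2, 1 / 2, -1 / 6]
  else if s = q + K then [1 / 4, -1]
  else if s = q + K + 1 then [1]
  else []

end SplineNet

open SplineNet in
/-- A ReQU network computing the quadratic B-splines with `K` uniform cells. -/
noncomputable def splineNet (q K : ℕ) : ReQUNet where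
  L := 4
  arch
    | 0 => 1
    | 1 => 4 * (K + 2 * q - 1) + K
    | 2 => 4 * K + 8 * q
    | 3 => 4 * K + 8 * q
    | 4 => 4 * K + 8 * q
    | _ => K + 2 * q
  W
    | 0, j => bandRow 0 (weightIn j)
    | 1, j => bandRow 0 (weightTwo K j)
    | 2, j => bandRow 0 (weightThree √(K : ℝ) j)
    | 3, j => bandRow 0 (weightFour K √(K : ℝ) j)
    | _, j => bandRow (baseOut q K j) (weightOut q K j)
  v
    | 1 => biasOne K
    | 2 => biasTwo
    | 3 => biasThree
    | 4 => biasFour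
    | _ => 0

namespace SplineNet

variable {q K : ℕ}

theorem card_weights_le (n m : ℕ) (b : ℕ → ℕ) (l : ℕ → List ℝ) {w c : ℕ}
    (h : ∀ j, (l j).length ≤ c) (h0 : ∀ j, w ≤ j → l j = []) :
    ((Finset.range n ×ˢ Finset.range m).filter
      fun p => bandRow (b p.1) (l p.1) p.2 ≠ 0).card ≤ w * c :=
  (card_bandRow_le b l n m).trans
    (sum_range_le_mul n h fun j hj => by rw [h0 j hj, List.length_nil])

theorem length_weightFour_le (r : ℝ) (j : ℕ) : (weightFour K r j).length ≤ 6 := by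
  unfold weightFour
  split <;> (try split_ifs) <;> simp

theorem weightFour_eq_nil (r : ℝ) {j : ℕ} (hj : K + 7 ≤ j) : weightFour K r j = [] := by
  obtain ⟨i, rfl⟩ : ∃ i, j = i + 6 := ⟨j - 6, by omega⟩
  rw [weightFour, if_neg (by omega)]

theorem length_weightOut_le (s : ℕ) : (weightOut q K s).length ≤ 4 := by
  unfold weightOut
  split_ifs <;> simp

theorem weightOut_eq_nil (hq : 2 ≤ q) {s : ℕ} (hs : K + 2 * q ≤ s) :
    weightOut q K s = [] := by
  unfold weightOut
  split_ifs <;> first | rfl | (exfalso; omega)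

theorem numNonzero_le (hq : 2 ≤ q) (hK : 2 ≤ K) :
    (splineNet q K).numNonzero ≤ 72 * (K + 2 * q) := by
  have h0 := card_weights_le (4 * (K + 2 * q - 1) + K) 1 (fun _ => 0) weightIn
    (w := 2) (c := 1) (fun j => by unfold weightIn; split_ifs <;> simp)
    (fun j hj => by unfold weightIn; rw [if_neg (by omega)])
  have h1 := card_weights_le (4 * K + 8 * q) (4 * (K + 2 * q - 1) + K) (fun _ => 0) (weightTwo K)
    (w := 4) (c := K + 2) (fun j => by unfold weightTwo; split <;> simp)
    (fun j hj => by unfold weightTwo; split <;> first | rfl | (exfalso; omega))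
  have h2 := card_weights_le (4 * K + 8 * q) (4 * K + 8 * q) (fun _ => 0) (weightThree √(K : ℝ))
    (w := 6) (c := 4) (fun j => by unfold weightThree; split <;> simp)
    (fun j hj => by unfold weightThree; split <;> first | rfl | (exfalso; omega))
  have h3 := card_weights_le (4 * K + 8 * q) (4 * K + 8 * q) (fun _ => 0) (weightFour K √(K : ℝ))
    (length_weightFour_le _) (fun j hj => weightFour_eq_nil _ hj)
  have h4 := card_weights_le (K + 2 * q) (4 * K + 8 * q) (baseOut q K) (weightOut q K)
    length_weightOut_le (fun j hj => weightOut_eq_nil hq hj)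
  have v1 := card_ne_zero_le (f := biasOne K) (m := K + 2) (4 * (K + 2 * q - 1) + K)
    (fun j hj => by unfold biasOne; rw [if_neg (by omega)])
  have v2 := card_ne_zero_le (f := biasTwo) (m := 4) (4 * K + 8 * q)
    (fun j hj => by unfold biasTwo; split <;> first | rfl | (exfalso; omega))
  have v3 := card_ne_zero_le (f := biasThree) (m := 5) (4 * K + 8 * q)
    (fun j hj => by unfold biasThree; split <;> first | rfl | (exfalso; omega))
  have v4 := card_ne_zero_le (f := biasFour) (m := 3) (4 * K + 8 * q)
    (fun j hj => by unfold biasFour; split <;> first | rfl | (exfalso; omega))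
  have hI : Finset.Icc 1 4 = ({1, 2, 3, 4} : Finset ℕ) := rfl
  simp only [ReQUNet.numNonzero, splineNet, Finset.sum_range_succ, Finset.sum_range_zero, hI,
    zero_add, Nat.reduceAdd]
  rw [Finset.sum_insert (by decide), Finset.sum_insert (by decide),
    Finset.sum_insert (by decide), Finset.sum_singleton]
  simp only [] at *
  omega

theorem one_le_sqrt (hK : 2 ≤ K) : 1 ≤ √(K : ℝ) := by
  rw [Real.one_le_sqrt]
  exact_mod_cast (by omega : 1 ≤ K)

theorem div_sqrt_pow_mem (hK : 2 ≤ K) {i : ℕ} (hi : i ≤ K) :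
    (i : ℝ) / √(K : ℝ) ^ 3 ∈ Set.Icc (0 : ℝ) 1 := by
  have h1 := one_le_sqrt hK
  refine ⟨by positivity, (div_le_one (by positivity)).mpr ?_⟩
  calc (i : ℝ) ≤ K := by exact_mod_cast hi
    _ = √(K : ℝ) ^ 2 := (Real.sq_sqrt (Nat.cast_nonneg K)).symm
    _ ≤ √(K : ℝ) ^ 3 := pow_le_pow_right₀ h1 (by norm_num)

theorem weightsIn_Icc (hK : 2 ≤ K) : (splineNet q K).weightsIn (Set.Icc (-1) 1) := by
  have hr := one_le_sqrt hK
  constructor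
  · intro i hi j _ k _
    change i ≤ 4 at hi
    interval_cases i <;> simp only [splineNet] <;> apply bandRow_mem
    · unfold weightIn
      split_ifs <;> simp
    · unfold weightTwo
      split <;> simp [List.mem_replicate] <;> norm_num
    · have h1 : 1 / (2 * √(K : ℝ)) ∈ Set.Icc (0 : ℝ) 1 :=
        ⟨by positivity, (div_le_one (by positivity)).mpr (by linarith)⟩
      have h2 : 1 / √(K : ℝ) ^ 2 ∈ Set.Icc (0 : ℝ) 1 :=
        ⟨by positivity, (div_le_one (by positivity)).mpr (one_le_pow₀ hr)⟩
      simp only [Set.mem_Icc] at *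
      unfold weightThree
      split <;> simp only [List.mem_cons, List.not_mem_nil, or_false, forall_eq_or_imp, forall_eq,
        neg_div] <;> grind
    · have h1 := div_sqrt_pow_mem hK (i := 1) (by omega)
      have h2 := div_sqrt_pow_mem hK hK
      simp only [Set.mem_Icc, Nat.cast_one, Nat.cast_ofNat] at *
      unfold weightFour
      split
      case h_7 i =>
        split_ifs with hi
        · have h3 := div_sqrt_pow_mem hK hi
          simp only [Set.mem_Icc] at h3
          simp only [List.mem_cons, List.not_mem_nil, or_false, forall_eq_or_imp, forall_eq,
            neg_div]
          grind
        · simp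
      all_goals
        simp only [List.mem_cons, List.not_mem_nil, or_false, forall_eq_or_imp, forall_eq,
          neg_div]
        grind
    · unfold weightOut
      split_ifs <;> simp <;> norm_num
  · intro i h1 hi j _
    change i ≤ 4 at hi
    interval_cases i
    · change biasOne K j ∈ _
      unfold biasOne
      split_ifs <;> norm_num
    · change biasTwo j ∈ _
      unfold biasTwo
      split <;> norm_num
    · change biasThree j ∈ _
      unfold biasThree
      split <;> norm_num
    · change biasFour j ∈ _
      unfold biasFour
      split <;> norm_num

/-- Output of the `k`-th neuron in layer `i + 1` of the spline network at `x`. -/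
noncomputable def act (q K : ℕ) (x : ℝ) (i k : ℕ) : ℝ :=
  requ ((splineNet q K).hidden (fun _ => x) i k - (splineNet q K).v (i + 1) k)

theorem hidden_zero (x : ℝ) (j : ℕ) :
    (splineNet q K).hidden (fun _ => x) 0 j = if j ≤ 1 then x else 0 := by
  simp only [ReQUNet.hidden, splineNet, Finset.sum_range_one, bandRow, weightIn]
  split_ifs <;> simp_all

theorem hidden_one (x : ℝ) {j : ℕ} (h : (weightTwo K j).length ≤ 4 * (K + 2 * q - 1) + K) :
    (splineNet q K).hidden (fun _ => x) 1 j
      = ∑ d ∈ Finset.range (weightTwo K j).length,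
          (weightTwo K j).getD d 0 * act q K x 0 d := by
  have := sum_bandRow (b := 0) (act q K x 0) (by simpa using h)
  simp only [zero_add] at this
  exact this

theorem hidden_two (x : ℝ) {j : ℕ} (h : (weightThree √(K : ℝ) j).length ≤ 4 * K + 8 * q) :
    (splineNet q K).hidden (fun _ => x) 2 j
      = ∑ d ∈ Finset.range (weightThree √(K : ℝ) j).length,
          (weightThree √(K : ℝ) j).getD d 0 * act q K x 1 d := by
  have := sum_bandRow (b := 0) (act q K x 1) (by simpa using h)
  simp only [zero_add] at this
  exact this

theorem hidden_three (x : ℝ) {j : ℕ} (h : (weightFour K √(K : ℝ) j).length ≤ 4 * K + 8 * q) :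
    (splineNet q K).hidden (fun _ => x) 3 j
      = ∑ d ∈ Finset.range (weightFour K √(K : ℝ) j).length,
          (weightFour K √(K : ℝ) j).getD d 0 * act q K x 2 d := by
  have := sum_bandRow (b := 0) (act q K x 2) (by simpa using h)
  simp only [zero_add] at this
  exact this

theorem hidden_four (x : ℝ) {s : ℕ}
    (h : baseOut q K s + (weightOut q K s).length ≤ 4 * K + 8 * q) :
    (splineNet q K).hidden (fun _ => x) 4 s
      = ∑ d ∈ Finset.range (weightOut q K s).length,
          (weightOut q K s).getD d 0 * act q K x 3 (baseOut q K s + d) :=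
  sum_bandRow (act q K x 3) h

section Values

variable {x : ℝ}

theorem act_zero_zero (hx : 0 ≤ x) : act q K x 0 0 = x ^ 2 := by
  rw [act, hidden_zero, if_pos (by norm_num)]
  simp [splineNet, biasOne, requ_of_nonneg hx]

theorem act_zero_one (hx : 0 ≤ x) : act q K x 0 1 = (x + 1) ^ 2 := by
  rw [act, hidden_zero, if_pos le_rfl]
  simp [splineNet, biasOne, requ_of_nonneg (by linarith : 0 ≤ x + 1)]

theorem act_zero_const {d : ℕ} (hd : d < K) : act q K x 0 (d + 2) = 1 := by
  rw [act, hidden_zero, if_neg (by omega)]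
  simp [splineNet, biasOne, hd, requ]

theorem act_one (hq : 2 ≤ q) (hx : 0 ≤ x) :
    act q K x 1 0 = (K + x) ^ 2 ∧ act q K x 1 1 = K ^ 2 ∧ act q K x 1 2 = x ^ 2 ∧
      act q K x 1 3 = (x + 1) ^ 2 := by
  have hsum : ∑ d ∈ Finset.range K, (List.replicate K (1 : ℝ)).getD d 0 * act q K x 0 (d + 2)
      = K := by
    rw [Finset.sum_congr rfl (g := fun _ => (1 : ℝ))]
    · simp
    · intro d hd
      rw [Finset.mem_range] at hd
      rw [act_zero_const hd, List.getD_eq_getElem _ _ (by simpa using hd)]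
      simp
  have hK : (0 : ℝ) ≤ K := Nat.cast_nonneg K
  have h0 : (splineNet q K).hidden (fun _ => x) 1 0 = K + x + 1 / 2 := by
    rw [hidden_one x (by simp [weightTwo]; omega)]
    simp only [weightTwo, List.length_cons, List.length_replicate, Finset.sum_range_succ',
      List.getD_cons_succ, List.getD_cons_zero, zero_add, add_assoc, Nat.reduceAdd, hsum,
      act_zero_zero hx, act_zero_one hx]
    ring
  have h1 : (splineNet q K).hidden (fun _ => x) 1 1 = K := by
    rw [hidden_one x (by simp [weightTwo]; omega)]
    simp only [weightTwo, List.length_cons, List.length_replicate, Finset.sum_range_succ',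
      List.getD_cons_succ, List.getD_cons_zero, zero_add, add_assoc, Nat.reduceAdd, hsum]
    ring
  have h2 : (splineNet q K).hidden (fun _ => x) 1 2 = x + 1 / 2 := by
    rw [hidden_one x (by simp [weightTwo]; omega)]
    simp [weightTwo, Finset.sum_range_succ, act_zero_zero hx, act_zero_one hx]
    ring
  have h3 : (splineNet q K).hidden (fun _ => x) 1 3 = x + 1 / 2 := by
    rw [hidden_one x (by simp [weightTwo]; omega)]
    simp [weightTwo, Finset.sum_range_succ, act_zero_zero hx, act_zero_one hx]
    ring
  refine ⟨?_, ?_, ?_, ?_⟩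
  · rw [act, h0]
    simp [splineNet, biasTwo, requ_of_nonneg (add_nonneg hK hx)]
  · rw [act, h1]
    simp [splineNet, biasTwo, requ_of_nonneg hK]
  · rw [act, h2]
    simp [splineNet, biasTwo, requ_of_nonneg hx]
  · rw [act, h3, ← requ_of_nonneg (by linarith : 0 ≤ x + 1)]
    congr 1
    simp [splineNet, biasTwo]
    ring

theorem act_two (hq : 2 ≤ q) (hK : 2 ≤ K) (hx : 0 ≤ x) :
    act q K x 2 0 = (K + √(K : ℝ) * x) ^ 2 ∧ act q K x 2 1 = K ^ 2 ∧
      act q K x 2 2 = (√(K : ℝ) * x) ^ 2 ∧ act q K x 2 3 = x ^ 2 ∧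
      act q K x 2 4 = (x + 1) ^ 2 ∧ act q K x 2 5 = K ^ 2 := by
  obtain ⟨a0, a1, a2, a3⟩ := act_one (K := K) hq hx
  have hr := one_le_sqrt hK
  have hrK : √(K : ℝ) ^ 2 = K := Real.sq_sqrt (Nat.cast_nonneg K)
  set r := √(K : ℝ) with hrdef
  have hr0 : r ≠ 0 := by positivity
  have key : ∀ j : ℕ, ∀ u b : ℝ, 0 ≤ u → (splineNet q K).v 3 j = b →
      ∑ d ∈ Finset.range (weightThree r j).length,
        (weightThree r j).getD d 0 * act q K x 1 d = u + b →
      (weightThree r j).length ≤ 4 * K + 8 * q → act q K x 2 j = u ^ 2 := by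
    intro j u b hu hb hs hl
    rw [act, hidden_two x hl, ← hrdef, hs, hb, add_sub_cancel_right, requ_of_nonneg hu]
  refine ⟨key 0 _ 0 (by positivity) rfl ?_ ?_, key 1 _ 0 (by positivity) rfl ?_ ?_,
    key 2 _ 0 (by positivity) rfl ?_ ?_, key 3 _ (1 / 2) hx rfl ?_ ?_,
    key 4 _ (-1 / 2) (by positivity) rfl ?_ ?_, key 5 _ 0 (by positivity) rfl ?_ ?_⟩
  all_goals
    simp only [weightThree, List.length_cons, List.length_nil, zero_add, Nat.reduceAdd,
      Finset.sum_range_succ, Finset.sum_range_zero, List.getD_cons_zero, List.getD_cons_succ,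
      a0, a1, a2, a3, ← hrK]
    first | omega | (field_simp; ring)

theorem act_three (hq : 2 ≤ q) (hK : 2 ≤ K) (hx : 0 ≤ x) :
    act q K x 3 0 = x ^ 2 ∧ act q K x 3 1 = (x + 1) ^ 2 ∧ act q K x 3 2 = 1 ∧
      act q K x 3 3 = K ∧ act q K x 3 4 = K * requ (1 - K * x) ∧
      act q K x 3 5 = K * requ (2 - K * x) ∧
      ∀ i ≤ K, act q K x 3 (6 + i) = K * requ (K * x - i) := by
  obtain ⟨a0, a1, a2, a3, a4, a5⟩ := act_two hq hK hx
  have hr := one_le_sqrt hK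
  have hrK : √(K : ℝ) ^ 2 = K := Real.sq_sqrt (Nat.cast_nonneg K)
  set r := √(K : ℝ) with hrdef
  have hr0 : r ≠ 0 := by positivity
  have key : ∀ j : ℕ, ∀ u b : ℝ, (splineNet q K).v 4 j = b →
      ∑ d ∈ Finset.range (weightFour K r j).length,
        (weightFour K r j).getD d 0 * act q K x 2 d = u + b →
      act q K x 3 j = requ u := by
    intro j u b hb hs
    have hl := length_weightFour_le (K := K) r j
    rw [act, hidden_three x (by rw [← hrdef]; omega), ← hrdef, hs, hb, add_sub_cancel_right]
  have key' : ∀ j : ℕ, ∀ u : ℝ, (splineNet q K).v 4 j = 0 →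
      ∑ d ∈ Finset.range (weightFour K r j).length,
        (weightFour K r j).getD d 0 * act q K x 2 d = r * u →
      act q K x 3 j = K * requ u := by
    intro j u hb hs
    rw [key j (r * u) 0 hb (by rw [hs, add_zero]), requ_mul (by positivity), hrK]
  refine ⟨?_, ?_, ?_, ?_, key' 4 _ rfl ?_, key' 5 _ rfl ?_, fun i hi => key' _ _ ?_ ?_⟩
  · rw [key 0 x (1 / 2) rfl, requ_of_nonneg hx]
    simp [weightFour, Finset.sum_range_succ, a3, a4]
    ring
  · rw [key 1 (x + 1) (-1 / 2) rfl, requ_of_nonneg (by positivity)]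
    simp [weightFour, Finset.sum_range_succ, a3, a4]
    ring
  · rw [key 2 1 (-1) rfl, requ_of_nonneg zero_le_one, one_pow]
    simp [weightFour]
  · rw [key 3 r 0 rfl, requ_of_nonneg (by positivity), hrK]
    simp only [weightFour, List.length_cons, List.length_nil, zero_add, Nat.reduceAdd,
      Finset.sum_range_succ, Finset.sum_range_zero, List.getD_cons_zero, List.getD_cons_succ,
      a0, a1, ← hrK]
    field_simp
    ring
  · simp only [weightFour, List.length_cons, List.length_nil, zero_add, Nat.reduceAdd,
      Finset.sum_range_succ, Finset.sum_range_zero, List.getD_cons_zero, List.getD_cons_succ,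
      a0, a1, a2, a3, a4, a5, ← hrK]
    field_simp
    ring
  · simp only [weightFour, List.length_cons, List.length_nil, zero_add, Nat.reduceAdd,
      Finset.sum_range_succ, Finset.sum_range_zero, List.getD_cons_zero, List.getD_cons_succ,
      a0, a1, a2, a3, a4, a5, ← hrK]
    field_simp
    ring
  · rw [add_comm]
    rfl
  · rw [add_comm 6 i]
    simp only [weightFour, if_pos hi, List.length_cons, List.length_nil, zero_add, Nat.reduceAdd,
      Finset.sum_range_succ, Finset.sum_range_zero, List.getD_cons_zero, List.getD_cons_succ,
      a0, a1, a2, a3, a4, a5, ← hrK]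
    field_simp
    ring

end Values

theorem knot_eq (hK : 0 < K) (j : ℕ) : knot q K j = (min (j - (q + 1)) K : ℕ) / (K : ℝ) := by
  unfold knot
  split_ifs with h1 h2
  · rw [Nat.sub_eq_zero_of_le h1]
    simp
  · rw [min_eq_left (by omega)]
  · rw [min_eq_right (by omega), div_self (by positivity)]

theorem Bspl_two_eq (hK : 0 < K) {j m₀ m₁ m₂ m₃ : ℕ} (x : ℝ)
    (h₀ : min (j - (q + 1)) K = m₀) (h₁ : min (j + 1 - (q + 1)) K = m₁)
    (h₂ : min (j + 2 - (q + 1)) K = m₂) (h₃ : min (j + 3 - (q + 1)) K = m₃) :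
    Bspl q K 2 j x = K * bsplTwo m₀ m₁ m₂ m₃ (K * x) := by
  have hK' : (0 : ℝ) < K := Nat.cast_pos.mpr hK
  rw [Bspl_two, knot_eq hK, knot_eq hK, knot_eq hK, knot_eq hK, h₀, h₁, h₂, h₃,
    ← bsplTwo_div hK', mul_div_cancel_left₀ x hK'.ne']

theorem hidden_four_spline (hq : 2 ≤ q) (hK : 2 ≤ K) {x : ℝ} (hx : 0 ≤ x) (hx1 : x < 1)
    {j : ℕ} (hj : 1 ≤ j) :
    (splineNet q K).hidden (fun _ => x) 4 (j + 1) = Bspl q K 2 j x := by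
  obtain ⟨-, -, -, -, c4, c5, c6⟩ := act_three hq hK hx
  have hK0 : 0 < K := by omega
  have hy : 0 ≤ (K : ℝ) * x := by positivity
  have hyK : (K : ℝ) * x < K := by
    have : (0 : ℝ) < K := Nat.cast_pos.mpr hK0
    nlinarith
  have hw : baseOut q K (j + 1) + (weightOut q K (j + 1)).length ≤ 4 * K + 8 * q := by
    have := length_weightOut_le (q := q) (K := K) (j + 1)
    have hb : baseOut q K (j + 1) ≤ K + 5 := by
      unfold baseOut
      split_ifs <;> omega
    omega
  rw [hidden_four x hw]
  have n0 : j + 1 ≠ 0 := by omega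
  have n1 : j + 1 ≠ 1 := by omega
  rcases lt_or_ge (j + 1) q with h | h
  · have hl : weightOut q K (j + 1) = [] := by
      unfold weightOut
      split_ifs <;> first | rfl | (exfalso; omega)
    rw [hl, Bspl_two_eq hK0 (m₀ := 0) (m₁ := 0) (m₂ := 0) (m₃ := 0) x
      (by omega) (by omega) (by omega) (by omega)]
    simp [bsplTwo]
  rcases h.eq_or_lt with h | h
  · have hl : weightOut q K (j + 1) = [1] := by
      rw [weightOut, if_neg n0, if_neg n1, if_pos h.symm]
    have hb : baseOut q K (j + 1) = 4 := by
      rw [baseOut, if_neg n0, if_neg n1, if_pos (Or.inl h.symm)]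
    rw [hl, hb, Bspl_two_eq hK0 (m₀ := 0) (m₁ := 0) (m₂ := 0) (m₃ := 1) x
      (by omega) (by omega) (by omega) (by omega)]
    simp [c4, bsplTwo_left_triple hy]
  rcases (Nat.succ_le_of_lt h).eq_or_lt with h' | h'
  · have hl : weightOut q K (j + 1) = [-1, 1 / 4] := by
      rw [weightOut, if_neg n0, if_neg n1, if_neg h.ne', if_pos h'.symm]
    have hb : baseOut q K (j + 1) = 4 := by
      rw [baseOut, if_neg n0, if_neg n1, if_pos (Or.inr h'.symm)]
    rw [hl, hb, Bspl_two_eq hK0 (m₀ := 0) (m₁ := 0) (m₂ := 1) (m₃ := 2) x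
      (by omega) (by omega) (by omega) (by omega)]
    simp [Finset.sum_range_succ, c4, c5, bsplTwo_left_double hy]
    ring
  obtain ⟨i, rfl⟩ : ∃ i, j = q + 1 + i := ⟨j - (q + 1), by omega⟩
  have hb (hi : i < K) : baseOut q K (q + 1 + i + 1) = 6 + i := by
    rw [baseOut, if_neg n0, if_neg n1, if_neg (by omega), if_pos (by omega)]
    omega
  rcases lt_or_ge (i + 2) K with hi | hi
  · have hl : weightOut q K (q + 1 + i + 1) = [1 / 6, -1 / 2, 1 / 2, -1 / 6] := by
      rw [weightOut, if_neg n0, if_neg n1, if_neg (by omega), if_neg (by omega),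
        if_pos (by omega)]
    rw [hl, hb (by omega), Bspl_two_eq hK0 (m₀ := i) (m₁ := i + 1) (m₂ := i + 2) (m₃ := i + 3) x
      (by omega) (by omega) (by omega) (by omega)]
    push_cast
    rw [bsplTwo_uniform]
    simp [Finset.sum_range_succ, add_assoc, c6 i (by omega), c6 (i + 1) (by omega),
      c6 (i + 2) (by omega), c6 (i + 3) (by omega)]
    ring
  rcases hi.eq_or_lt with hi | hi
  · have hl : weightOut q K (q + 1 + i + 1) = [1 / 4, -1] := by
      rw [weightOut, if_neg n0, if_neg n1, if_neg (by omega), if_neg (by omega),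
        if_neg (by omega), if_pos (by omega)]
    have hi' : (K : ℝ) = i + 2 := by exact_mod_cast hi
    rw [hl, hb (by omega), Bspl_two_eq hK0 (m₀ := i) (m₁ := i + 1) (m₂ := i + 2) (m₃ := i + 2) x
      (by omega) (by omega) (by omega) (by omega)]
    push_cast
    rw [bsplTwo_right_double (by linarith)]
    simp [Finset.sum_range_succ, add_assoc, c6 i (by omega), c6 (i + 1) (by omega)]
    ring
  rcases (Nat.succ_le_of_lt hi).eq_or_lt with hi₁ | hi₁
  · have hl : weightOut q K (q + 1 + i + 1) = [1] := by
      rw [weightOut, if_neg n0, if_neg n1, if_neg (by omega), if_neg (by omega),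
        if_neg (by omega), if_neg (by omega), if_pos (by omega)]
    have hi' : (K : ℝ) = i + 1 := by exact_mod_cast (by omega : K = i + 1)
    rw [hl, hb (by omega), Bspl_two_eq hK0 (m₀ := i) (m₁ := i + 1) (m₂ := i + 1) (m₃ := i + 1) x
      (by omega) (by omega) (by omega) (by omega)]
    push_cast
    rw [bsplTwo_right_triple (by linarith)]
    simp [c6 i (by omega)]
  · have hl : weightOut q K (q + 1 + i + 1) = [] := by
      unfold weightOut
      split_ifs <;> first | rfl | (exfalso; omega)
    rw [hl, Bspl_two_eq hK0 (m₀ := K) (m₁ := K) (m₂ := K) (m₃ := K) x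
      (by omega) (by omega) (by omega) (by omega)]
    simp [bsplTwo]

end SplineNet

theorem statement6 (q K : ℕ) (hq : 2 ≤ q) (hK : 2 ≤ K) :
    ∃ N : ReQUNet,
      N.L = 4 ∧
      N.arch 0 = 1 ∧ N.arch 1 = 4 * (K + 2 * q - 1) + K ∧
      N.arch 2 = 4 * K + 8 * q ∧ N.arch 3 = 4 * K + 8 * q ∧ N.arch 4 = 4 * K + 8 * q ∧
      N.arch 5 = K + 2 * q ∧
      N.weightsIn (Set.Icc (-1) 1) ∧
      N.numNonzero ≤ 72 * (K + 2 * q) ∧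
      ∀ x : ℝ, 0 ≤ x → x < 1 →
        N.eval (fun _ => x) 0 = x ∧
        N.eval (fun _ => x) 1 = (K : ℝ) ∧
        ∀ j : ℕ, 1 ≤ j → j ≤ K + 2 * q - 2 →
          N.eval (fun _ => x) (j + 1) = Bspl q K 2 j x := by
  refine ⟨splineNet q K, rfl, rfl, rfl, rfl, rfl, rfl, rfl, SplineNet.weightsIn_Icc hK,
    SplineNet.numNonzero_le hq hK, fun x hx hx1 => ⟨?_, ?_, fun j hj _ =>
      SplineNet.hidden_four_spline hq hK hx hx1 hj⟩⟩
  · obtain ⟨c0, c1, c2, -⟩ := SplineNet.act_three hq hK hx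
    refine (SplineNet.hidden_four x ?_).trans ?_
    · simp [SplineNet.baseOut, SplineNet.weightOut]
      omega
    · simp [SplineNet.baseOut, SplineNet.weightOut, Finset.sum_range_succ, c0, c1, c2]
      ring
  · obtain ⟨-, -, -, c3, -⟩ := SplineNet.act_three hq hK hx
    refine (SplineNet.hidden_four x ?_).trans ?_
    · simp [SplineNet.baseOut, SplineNet.weightOut]
      omega
    · simp [SplineNet.baseOut, SplineNet.weightOut, c3]
end

section
/- Let q ≥ 2 and K ≥ 2 be integers and let a be the associated knot vector. Then for every m ∈ {1, …, q}, every ℓ ∈ {1, …, m}, every j ∈ {1, …, 2q+K−m}, and every x ∈ [0,1) that is not of the form i/K for an integer i, the ℓ-th derivative of the normalized B-spline N_j^{m,K} exists at x and satisfies |(d/dx)^ℓ N_j^{m,K}(x)| ≤ (2K)^ℓ · m!/(m−ℓ)!. -/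
open scoped BigOperators Classical

theorem knot_eq (q : ℕ) {K : ℕ} (hK : 0 < K) (j : ℕ) :
    knot q K j = ((min (j - (q + 1)) K : ℕ) : ℝ) / K := by
  have hK' : (K : ℝ) ≠ 0 := by positivity
  unfold knot
  split_ifs with h₁ h₂
  · rw [show j - (q + 1) = 0 by omega]
    simp
  · rw [min_eq_left (by omega)]
  · rw [min_eq_right (by omega), div_self hK']

theorem knot_mono (q : ℕ) {K : ℕ} (hK : 0 < K) : Monotone (knot q K) := by
  intro i j hij
  rw [knot_eq q hK, knot_eq q hK]
  gcongr

theorem inv_knot_sub_le (q : ℕ) {K : ℕ} (hK : 0 < K) {i j : ℕ} (hij : i ≤ j) :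
    (knot q K j - knot q K i)⁻¹ ≤ K := by
  have hK' : (0 : ℝ) < K := by positivity
  rw [knot_eq q hK, knot_eq q hK, ← sub_div, inv_div]
  have hle : min (i - (q + 1)) K ≤ min (j - (q + 1)) K := by gcongr
  rw [← Nat.cast_sub hle]
  rcases Nat.eq_zero_or_pos (min (j - (q + 1)) K - min (i - (q + 1)) K) with h | h
  · simp [h]
  · exact div_le_self hK'.le (by exact_mod_cast h)

theorem Bspl_eq_zero {q K m j : ℕ} {x : ℝ}
    (h : ¬(knot q K j ≤ x ∧ x < knot q K (j + m + 1))) : Bspl q K m j x = 0 := by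
  cases m with
  | zero => exact if_neg fun h' => h h'.2
  | succ m => exact if_neg fun h' => h h'.2

/-- The recursion holds without case distinction, since the B-splines vanish off their support. -/
theorem Bspl_succ (q : ℕ) {K : ℕ} (hK : 0 < K) (m j : ℕ) (x : ℝ) :
    Bspl q K (m + 1) j x =
      ((x - knot q K j) * Bspl q K m j x
        + (knot q K (j + m + 2) - x) * Bspl q K m (j + 1) x) /
      (knot q K (j + m + 2) - knot q K j) := by
  rw [Bspl]
  split_ifs with h
  · rfl
  · have h₁ : knot q K (j + m + 1) ≤ knot q K (j + m + 2) := knot_mono q hK (by omega)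
    have h₂ : knot q K j ≤ knot q K (j + 1) := knot_mono q hK (by omega)
    rw [Bspl_eq_zero (m := m) (j := j), Bspl_eq_zero (m := m) (j := j + 1)]
    · simp
    · rw [show j + 1 + m + 1 = j + m + 2 by omega]
      rintro ⟨h₃, h₄⟩
      exact h ⟨by linarith, by linarith, h₄⟩
    · rintro ⟨h₃, h₄⟩
      exact h ⟨by linarith, h₃, by linarith⟩

theorem Bspl_eq_inv_mul_Nspl (q K m j : ℕ) (x : ℝ) :
    Bspl q K m j x = (knot q K (j + m + 1) - knot q K j)⁻¹ * Nspl q K m j x := by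
  by_cases h : knot q K j ≤ x ∧ x < knot q K (j + m + 1)
  · have : knot q K (j + m + 1) - knot q K j ≠ 0 := by linarith
    rw [Nspl, inv_mul_cancel_left₀ this]
  · rw [Nspl, Bspl_eq_zero h]
    simp

theorem Nspl_succ (q : ℕ) {K : ℕ} (hK : 0 < K) (m j : ℕ) (x : ℝ) :
    Nspl q K (m + 1) j x =
      (x - knot q K j) * Bspl q K m j x
        + (knot q K (j + m + 2) - x) * Bspl q K m (j + 1) x := by
  rw [Nspl, Bspl_succ q hK, show j + (m + 1) + 1 = j + m + 2 by omega]
  by_cases hd : knot q K (j + m + 2) - knot q K j = 0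
  · have h₁ : knot q K (j + m + 1) ≤ knot q K (j + m + 2) := knot_mono q hK (by omega)
    have h₂ : knot q K j ≤ knot q K (j + 1) := knot_mono q hK (by omega)
    rw [Bspl_eq_zero (m := m) (j := j), Bspl_eq_zero (m := m) (j := j + 1)]
    · simp
    · rw [show j + 1 + m + 1 = j + m + 2 by omega]
      rintro ⟨h₃, h₄⟩
      linarith
    · rintro ⟨h₃, h₄⟩
      linarith
  · rw [mul_div_cancel₀ _ hd]

theorem Bspl_nonneg (q K m j : ℕ) (x : ℝ) : 0 ≤ Bspl q K m j x := by
  induction m generalizing j with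
  | zero =>
    rw [Bspl]
    split_ifs with h
    · exact one_div_nonneg.2 (by linarith [h.1])
    · rfl
  | succ m ih =>
    rw [Bspl]
    split_ifs with h
    · have h₁ := ih j
      have h₂ := ih (j + 1)
      exact div_nonneg (add_nonneg (mul_nonneg (by linarith) h₁) (mul_nonneg (by linarith) h₂))
        (by linarith)
    · rfl

theorem sub_knot_mul_Bspl_nonneg (q K m j : ℕ) (x : ℝ) :
    0 ≤ (x - knot q K j) * Bspl q K m j x := by
  by_cases h : knot q K j ≤ x ∧ x < knot q K (j + m + 1)
  · exact mul_nonneg (by linarith) (Bspl_nonneg q K m j x)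
  · simp [Bspl_eq_zero h]

theorem knot_sub_mul_Bspl_nonneg (q K m j : ℕ) (x : ℝ) :
    0 ≤ (knot q K (j + m + 1) - x) * Bspl q K m j x := by
  by_cases h : knot q K j ≤ x ∧ x < knot q K (j + m + 1)
  · exact mul_nonneg (by linarith) (Bspl_nonneg q K m j x)
  · simp [Bspl_eq_zero h]

theorem Nspl_nonneg (q : ℕ) {K : ℕ} (hK : 0 < K) (m j : ℕ) (x : ℝ) : 0 ≤ Nspl q K m j x :=
  mul_nonneg (sub_nonneg.2 (knot_mono q hK (by omega))) (Bspl_nonneg q K m j x)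

theorem Nspl_zero (q : ℕ) {K : ℕ} (hK : 0 < K) (j : ℕ) (x : ℝ) :
    Nspl q K 0 j x =
      (if knot q K j ≤ x then 1 else 0) - (if knot q K (j + 1) ≤ x then 1 else 0) := by
  have h₁ : knot q K j ≤ knot q K (j + 1) := knot_mono q hK (by omega)
  rw [Nspl, Bspl, add_zero]
  split_ifs with h₂ h₃ h₄ h₅ h₆ h₇ <;> grind

theorem sum_Nspl_le_one (q : ℕ) {K : ℕ} (hK : 0 < K) (m s n : ℕ) (x : ℝ) :
    ∑ i ∈ Finset.range n, Nspl q K m (s + i) x ≤ 1 := by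
  induction m generalizing n with
  | zero =>
    simp only [Nspl_zero q hK, add_assoc s]
    rw [Finset.sum_range_sub' (fun i => if knot q K (s + i) ≤ x then (1 : ℝ) else 0)]
    split_ifs <;> norm_num
  | succ m ih =>
    refine le_trans ?_ (ih (n + 1))
    have hN : ∀ i, Nspl q K m i x = (x - knot q K i) * Bspl q K m i x
        + (knot q K (i + m + 1) - x) * Bspl q K m i x := fun i => by
      rw [Nspl]
      ring
    simp only [Nspl_succ q hK, hN, Finset.sum_add_distrib]
    refine add_le_add ?_ ?_
    · rw [Finset.sum_range_succ]
      exact le_add_of_nonneg_right (sub_knot_mul_Bspl_nonneg q K m _ x)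
    · rw [Finset.sum_range_succ']
      refine le_trans (le_of_eq (Finset.sum_congr rfl fun i _ => ?_))
        (le_add_of_nonneg_right (knot_sub_mul_Bspl_nonneg q K m _ x))
      rw [show s + i + m + 2 = s + (i + 1) + m + 1 by omega, add_assoc s i 1]

theorem Nspl_le_one (q : ℕ) {K : ℕ} (hK : 0 < K) (m j : ℕ) (x : ℝ) : Nspl q K m j x ≤ 1 := by
  simpa using sum_Nspl_le_one q hK m j 1 x

theorem eventually_forall_ne_knot (q : ℕ) {K : ℕ} (hK : 0 < K) {x : ℝ}
    (hx : ∀ i, x ≠ knot q K i) : ∀ᶠ y in nhds x, ∀ i, y ≠ knot q K i := by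
  have hfin : (Set.range (knot q K)).Finite :=
    ((Set.finite_le_nat K).image fun n : ℕ => (n : ℝ) / K).subset <| by
      rintro _ ⟨i, rfl⟩
      exact ⟨min (i - (q + 1)) K, Nat.min_le_right _ _, (knot_eq q hK i).symm⟩
  have hmem : (Set.range (knot q K))ᶜ ∈ nhds x :=
    hfin.isClosed.isOpen_compl.mem_nhds fun ⟨i, hi⟩ => hx i hi.symm
  filter_upwards [hmem] with y hy i hi
  exact hy ⟨i, hi.symm⟩

theorem Bspl_zero_eventuallyEq (q K j : ℕ) {x : ℝ} (hx : ∀ i, x ≠ knot q K i) :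
    Bspl q K 0 j =ᶠ[nhds x] fun _ => Bspl q K 0 j x := by
  have side : ∀ i, ∀ᶠ y in nhds x, (y < knot q K i ↔ x < knot q K i) := fun i => by
    rcases lt_or_gt_of_ne (hx i) with h | h
    · filter_upwards [Iio_mem_nhds h] with y hy
      exact iff_of_true hy h
    · filter_upwards [Ioi_mem_nhds h] with y hy
      exact iff_of_false (not_lt.2 (le_of_lt hy)) (not_lt.2 h.le)
  filter_upwards [side j, side (j + 1)] with y h₁ h₂
  simp only [Bspl, ← not_lt (b := knot q K j), h₁, h₂]

theorem hasDerivAt_Bspl_succ (q : ℕ) {K : ℕ} (hK : 0 < K) (m j : ℕ) {x : ℝ}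
    (hx : ∀ i, x ≠ knot q K i) :
    HasDerivAt (Bspl q K (m + 1) j)
      ((m + 1) * (Bspl q K m j x - Bspl q K m (j + 1) x) /
        (knot q K (j + m + 2) - knot q K j)) x := by
  have step : ∀ {m j : ℕ} {b₁ b₂ : ℝ}, HasDerivAt (Bspl q K m j) b₁ x →
      HasDerivAt (Bspl q K m (j + 1)) b₂ x →
      (x - knot q K j) * b₁ + (knot q K (j + m + 2) - x) * b₂ =
        m * (Bspl q K m j x - Bspl q K m (j + 1) x) →
      HasDerivAt (Bspl q K (m + 1) j)
        ((m + 1) * (Bspl q K m j x - Bspl q K m (j + 1) x) /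
          (knot q K (j + m + 2) - knot q K j)) x := by
    intro m j b₁ b₂ h₁ h₂ hb
    rw [show Bspl q K (m + 1) j = _ from funext (Bspl_succ q hK m j)]
    have h := ((((hasDerivAt_id x).sub_const (knot q K j)).mul h₁).add
      (((hasDerivAt_id x).const_sub (knot q K (j + m + 2))).mul h₂)).div_const
        (knot q K (j + m + 2) - knot q K j)
    refine h.congr_deriv ?_
    congr 1
    simp only [id]
    linear_combination hb
  induction m generalizing j with
  | zero =>
    have h₀ : ∀ j, HasDerivAt (Bspl q K 0 j) 0 x := fun j =>
      (hasDerivAt_const x _).congr_of_eventuallyEq (Bspl_zero_eventuallyEq q K j hx)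
    exact step (h₀ j) (h₀ (j + 1)) (by simp)
  | succ m ih =>
    refine step (ih j) (ih (j + 1)) ?_
    have hl : (x - knot q K j) * ((Bspl q K m j x - Bspl q K m (j + 1) x) /
        (knot q K (j + m + 2) - knot q K j)) = Bspl q K (m + 1) j x - Bspl q K m (j + 1) x := by
      by_cases hd : knot q K (j + m + 2) - knot q K j = 0
      · have h₂ : knot q K j ≤ knot q K (j + 1) := knot_mono q hK (by omega)
        rw [Bspl_succ q hK, hd, Bspl_eq_zero (m := m) (j := j + 1)]
        · simp
        · rw [show j + 1 + m + 1 = j + m + 2 by omega]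
          rintro ⟨h₃, h₄⟩
          linarith
      · rw [Bspl_succ q hK]
        field_simp
        ring
    have hr : (knot q K (j + 1 + m + 2) - x) *
        ((Bspl q K m (j + 1) x - Bspl q K m (j + 1 + 1) x) /
          (knot q K (j + 1 + m + 2) - knot q K (j + 1))) =
        Bspl q K m (j + 1) x - Bspl q K (m + 1) (j + 1) x := by
      by_cases hd : knot q K (j + 1 + m + 2) - knot q K (j + 1) = 0
      · have h₁ : knot q K (j + 1 + m + 1) ≤ knot q K (j + 1 + m + 2) :=
          knot_mono q hK (by omega)
        rw [Bspl_succ q hK, hd, Bspl_eq_zero (m := m) (j := j + 1)]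
        · simp
        · rintro ⟨h₃, h₄⟩
          linarith
      · rw [Bspl_succ q hK]
        field_simp
        ring
    rw [show j + (m + 1) + 2 = j + 1 + m + 2 by omega]
    push_cast
    linear_combination ((m : ℝ) + 1) * hl + ((m : ℝ) + 1) * hr

theorem contDiffAt_Bspl (q : ℕ) {K : ℕ} (hK : 0 < K) (n : WithTop ℕ∞) (m j : ℕ) {x : ℝ}
    (hx : ∀ i, x ≠ knot q K i) : ContDiffAt ℝ n (Bspl q K m j) x := by
  induction m generalizing j with
  | zero => exact contDiffAt_const.congr_of_eventuallyEq (Bspl_zero_eventuallyEq q K j hx)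
  | succ m ih =>
    rw [show Bspl q K (m + 1) j = _ from funext (Bspl_succ q hK m j)]
    exact (((contDiffAt_id.sub contDiffAt_const).mul (ih j)).add
      ((contDiffAt_const.sub contDiffAt_id).mul (ih (j + 1)))).div_const _

theorem contDiffAt_Nspl (q : ℕ) {K : ℕ} (hK : 0 < K) (n : WithTop ℕ∞) (m j : ℕ) {x : ℝ}
    (hx : ∀ i, x ≠ knot q K i) : ContDiffAt ℝ n (Nspl q K m j) x :=
  contDiffAt_const.mul (contDiffAt_Bspl q hK n m j hx)

theorem hasDerivAt_Nspl_succ (q : ℕ) {K : ℕ} (hK : 0 < K) (m j : ℕ) {x : ℝ}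
    (hx : ∀ i, x ≠ knot q K i) :
    HasDerivAt (Nspl q K (m + 1) j)
      ((m + 1) * (Bspl q K m j x - Bspl q K m (j + 1) x)) x := by
  refine ((hasDerivAt_Bspl_succ q hK m j hx).const_mul
    (knot q K (j + (m + 1) + 1) - knot q K j)).congr_deriv ?_
  rw [show j + (m + 1) + 1 = j + m + 2 by omega]
  by_cases hd : knot q K (j + m + 2) - knot q K j = 0
  · have h₁ : knot q K (j + m + 1) ≤ knot q K (j + m + 2) := knot_mono q hK (by omega)
    have h₂ : knot q K j ≤ knot q K (j + 1) := knot_mono q hK (by omega)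
    rw [Bspl_eq_zero (m := m) (j := j), Bspl_eq_zero (m := m) (j := j + 1)]
    · simp
    · rw [show j + 1 + m + 1 = j + m + 2 by omega]
      rintro ⟨h₃, h₄⟩
      linarith
    · rintro ⟨h₃, h₄⟩
      linarith
  · rw [mul_div_cancel₀ _ hd]

theorem abs_iteratedDeriv_Bspl_le (q : ℕ) {K : ℕ} (hK : 0 < K) (ℓ m j : ℕ) {x : ℝ}
    (hx : ∀ i, x ≠ knot q K i) :
    |iteratedDeriv ℓ (Bspl q K m j) x| ≤ K * |iteratedDeriv ℓ (Nspl q K m j) x| := by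
  rw [show Bspl q K m j = _ from funext (Bspl_eq_inv_mul_Nspl q K m j),
    iteratedDeriv_const_mul _ (contDiffAt_Nspl q hK ℓ m j hx), abs_mul,
    abs_of_nonneg (inv_nonneg.2 (sub_nonneg.2 (knot_mono q hK (by omega))))]
  gcongr
  exact inv_knot_sub_le q hK (by omega)

theorem abs_iteratedDeriv_Nspl_le (q : ℕ) {K : ℕ} (hK : 0 < K) {ℓ m : ℕ} (hlm : ℓ ≤ m) (j : ℕ)
    {x : ℝ} (hx : ∀ i, x ≠ knot q K i) :
    |iteratedDeriv ℓ (Nspl q K m j) x| ≤ (2 * (K : ℝ)) ^ ℓ * (m.descFactorial ℓ : ℝ) := by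
  induction ℓ generalizing m j with
  | zero => simpa [abs_of_nonneg (Nspl_nonneg q hK m j x)] using Nspl_le_one q hK m j x
  | succ ℓ ih =>
    obtain ⟨m, rfl⟩ : ∃ k, m = k + 1 := ⟨m - 1, by omega⟩
    have hderiv : deriv (Nspl q K (m + 1) j) =ᶠ[nhds x]
        fun y => ((m : ℝ) + 1) * (Bspl q K m j - Bspl q K m (j + 1)) y := by
      filter_upwards [eventually_forall_ne_knot q hK hx] with y hy
      exact (hasDerivAt_Nspl_succ q hK m j hy).deriv
    have hB : ∀ i, ContDiffAt ℝ ℓ (Bspl q K m i) x := fun i => contDiffAt_Bspl q hK ℓ m i hx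
    rw [iteratedDeriv_succ', hderiv.iteratedDeriv_eq,
      iteratedDeriv_const_mul (f := Bspl q K m j - Bspl q K m (j + 1)) _
        ((hB j).sub (hB (j + 1))),
      iteratedDeriv_sub (hB j) (hB (j + 1)), abs_mul, abs_of_nonneg (by positivity), Nat.succ_descFactorial_succ]
    have bound : ∀ i, |iteratedDeriv ℓ (Bspl q K m i) x| ≤
        K * ((2 * (K : ℝ)) ^ ℓ * (m.descFactorial ℓ : ℝ)) := fun i =>
      (abs_iteratedDeriv_Bspl_le q hK ℓ m i hx).trans
        (by gcongr; exact ih (by omega) i)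
    calc ((m : ℝ) + 1) * |iteratedDeriv ℓ (Bspl q K m j) x
            - iteratedDeriv ℓ (Bspl q K m (j + 1)) x|
        ≤ (m + 1) * (K * ((2 * (K : ℝ)) ^ ℓ * (m.descFactorial ℓ : ℝ))
            + K * ((2 * (K : ℝ)) ^ ℓ * (m.descFactorial ℓ : ℝ))) := by
          gcongr
          exact (abs_sub _ _).trans (add_le_add (bound j) (bound (j + 1)))
      _ = (2 * (K : ℝ)) ^ (ℓ + 1) * (((m + 1) * m.descFactorial ℓ : ℕ) : ℝ) := by
          push_cast
          ring

theorem statement9 (q K : ℕ) (hq : 2 ≤ q) (hK : 2 ≤ K)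
    (m : ℕ) (hm1 : 1 ≤ m) (hmq : m ≤ q)
    (ℓ : ℕ) (hl1 : 1 ≤ ℓ) (hlm : ℓ ≤ m)
    (j : ℕ) (hj1 : 1 ≤ j) (hj2 : j ≤ 2 * q + K - m)
    (x : ℝ) (hx0 : 0 ≤ x) (hx1 : x < 1) (hxk : ∀ i : ℤ, x ≠ (i : ℝ) / K) :
    (∀ r : ℕ, r < ℓ → DifferentiableAt ℝ (iteratedDeriv r (Nspl q K m j)) x) ∧
    |iteratedDeriv ℓ (Nspl q K m j) x| ≤
      (2 * (K : ℝ)) ^ ℓ * ((Nat.descFactorial m ℓ : ℕ) : ℝ) := by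
  have hK0 : 0 < K := by omega
  have hx : ∀ i, x ≠ knot q K i := fun i => by
    rw [knot_eq q hK0]
    simpa only [Int.cast_natCast] using hxk (min (i - (q + 1)) K : ℕ)
  refine ⟨fun r _ => ?_, abs_iteratedDeriv_Nspl_le q hK0 hlm j hx⟩
  have h : ContDiffAt ℝ (r + 1 : ℕ) (Nspl q K m j) x := contDiffAt_Nspl q hK0 _ m j hx
  rw [iteratedDeriv_eq_equiv_comp, LinearIsometryEquiv.comp_differentiableAt_iff]
  exact h.differentiableAt_iteratedFDeriv (by exact_mod_cast Nat.lt_succ_self r)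
end

section
/- Let β > 0, set q = ⌊β⌋ (so q < β), let H > 0, and let f : [0,1]^d → ℝ belong to the Hölder ball H^β([0,1]^d, H). Let a, x ∈ [0,1]^d, set r = max_{1≤i≤d} |x_i − a_i|, and let T(y) = Σ_{|α| ≤ q} D^α f(a) (y−a)^α / α! be the Taylor polynomial of f of degree q at a. Then for every multi-index γ with |γ| ≤ q: |D^γ f(x) − D^γ T(x)| ≤ H (r d)^{β − |γ|} / (q − |γ|)!. -/
open scoped BigOperators Classical

/-- Partial differentiation along the coordinates in `l`, `γ i` times along `i`. -/
noncomputable def listDeriv {d : ℕ} (l : List (Fin d)) (γ : Fin d → ℕ) (g : (Fin d → ℝ) → ℝ) :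
    (Fin d → ℝ) → ℝ :=
  l.foldr (fun i h => (pderiv1 i)^[γ i] h) g

lemma listDeriv_cons {d : ℕ} (j : Fin d) (l : List (Fin d)) (γ : Fin d → ℕ)
    (g : (Fin d → ℝ) → ℝ) :
    listDeriv (j :: l) γ g = (pderiv1 j)^[γ j] (listDeriv l γ g) := rfl

lemma mderiv_eq_listDeriv {d : ℕ} (γ : Fin d → ℕ) (g : (Fin d → ℝ) → ℝ) :
    mderiv γ g = listDeriv (List.finRange d) γ g := rfl

lemma ContDiff.pderiv1 {d n m : ℕ} {g : (Fin d → ℝ) → ℝ} (hg : ContDiff ℝ n g)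
    (h : m + 1 ≤ n) (i : Fin d) : ContDiff ℝ m (pderiv1 i g) := by
  have : ContDiff ℝ m (fderiv ℝ g) := hg.fderiv_right (by exact_mod_cast h)
  exact this.clm_apply contDiff_const

lemma ContDiff.iterate_pderiv1 {d m : ℕ} (i : Fin d) (k : ℕ) {n : ℕ} {g : (Fin d → ℝ) → ℝ}
    (hg : ContDiff ℝ n g) (h : m + k ≤ n) : ContDiff ℝ m ((_root_.pderiv1 i)^[k] g) := by
  induction k generalizing n g with
  | zero => exact hg.of_le (by exact_mod_cast h)
  | succ k ih =>
    rw [Function.iterate_succ_apply]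
    exact ih (hg.pderiv1 (m := m + k) (by omega) i) le_rfl

lemma ContDiff.listDeriv {d n : ℕ} {g : (Fin d → ℝ) → ℝ} (hg : ContDiff ℝ n g)
    (γ : Fin d → ℕ) (l : List (Fin d)) {m : ℕ} (h : m + (l.map γ).sum ≤ n) :
    ContDiff ℝ m (listDeriv l γ g) := by
  induction l generalizing m with
  | nil => exact hg.of_le (by exact_mod_cast h)
  | cons j l ih =>
    rw [List.map_cons, List.sum_cons] at h
    exact ContDiff.iterate_pderiv1 j (γ j) (ih (m := m + γ j) (by omega)) le_rfl

lemma pderiv1_comm {d : ℕ} {g : (Fin d → ℝ) → ℝ} (hg : ContDiff ℝ 2 g) (i j : Fin d) :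
    pderiv1 i (pderiv1 j g) = pderiv1 j (pderiv1 i g) := by
  have hd : Differentiable ℝ (fderiv ℝ g) :=
    (hg.fderiv_right (m := 1) (by norm_num)).differentiable one_ne_zero
  have key : ∀ (k l : Fin d) (x : Fin d → ℝ), pderiv1 k (pderiv1 l g) x =
      fderiv ℝ (fderiv ℝ g) x (Pi.single k 1) (Pi.single l 1) := by
    intro k l x
    have := ((hd x).hasFDerivAt.clm_apply
      (hasFDerivAt_const (Pi.single l (1 : ℝ) : Fin d → ℝ) x)).fderiv
    change fderiv ℝ (fun y => fderiv ℝ g y (Pi.single l 1)) x (Pi.single k 1) = _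
    rw [this]
    simp
  ext x
  rw [key, key]
  exact (hg.contDiffAt.isSymmSndFDerivAt (by simp)) _ _

lemma pderiv1_iterate_comm {d : ℕ} (i j : Fin d) (k : ℕ) {g : (Fin d → ℝ) → ℝ}
    (hg : ContDiff ℝ (k + 1 : ℕ) g) :
    pderiv1 i ((pderiv1 j)^[k] g) = (pderiv1 j)^[k] (pderiv1 i g) := by
  induction k generalizing g with
  | zero => rfl
  | succ k ih =>
    rw [Function.iterate_succ_apply, Function.iterate_succ_apply,
      ih (hg.pderiv1 le_rfl j), pderiv1_comm (hg.of_le _) i j]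
    exact_mod_cast (by omega : 2 ≤ k + 1 + 1)

lemma listDeriv_add_single_of_notMem {d : ℕ} (γ : Fin d → ℕ) (i : Fin d) (g : (Fin d → ℝ) → ℝ)
    (l : List (Fin d)) (hi : i ∉ l) : listDeriv l (γ + Pi.single i 1) g = listDeriv l γ g := by
  induction l with
  | nil => rfl
  | cons j l ih =>
    rw [List.mem_cons, not_or] at hi
    rw [listDeriv_cons, listDeriv_cons, ih hi.2]
    simp [Pi.single_eq_of_ne (Ne.symm hi.1)]

lemma pderiv1_listDeriv {d n : ℕ} {g : (Fin d → ℝ) → ℝ} (hg : ContDiff ℝ n g)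
    (γ : Fin d → ℕ) (i : Fin d) (l : List (Fin d)) (hl : l.Nodup) (hi : i ∈ l)
    (h : (l.map γ).sum + 1 ≤ n) :
    pderiv1 i (listDeriv l γ g) = listDeriv l (γ + Pi.single i 1) g := by
  induction l with
  | nil => simp at hi
  | cons j l ih =>
    rw [List.nodup_cons] at hl
    rw [List.map_cons, List.sum_cons] at h
    rw [listDeriv_cons, listDeriv_cons]
    by_cases hij : i = j
    · subst hij
      rw [listDeriv_add_single_of_notMem γ i g l hl.1, ← Function.iterate_succ_apply' (pderiv1 i)]
      simp
    · have hil : i ∈ l := (List.mem_cons.1 hi).resolve_left hij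
      rw [pderiv1_iterate_comm i j (γ j) (hg.listDeriv γ l (by omega)), ih hl.2 hil (by omega)]
      simp [Pi.single_eq_of_ne (Ne.symm hij)]

lemma sum_map_finRange {d : ℕ} (γ : Fin d → ℕ) : ((List.finRange d).map γ).sum = ∑ i, γ i := by
  rw [← List.ofFn_eq_map, List.sum_ofFn]

lemma ContDiff.mderiv {d n m : ℕ} {g : (Fin d → ℝ) → ℝ} (hg : ContDiff ℝ n g)
    (γ : Fin d → ℕ) (h : m + ∑ i, γ i ≤ n) : ContDiff ℝ m (mderiv γ g) :=
  hg.listDeriv γ _ (by rwa [sum_map_finRange])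

lemma pderiv1_mderiv {d n : ℕ} {g : (Fin d → ℝ) → ℝ} (hg : ContDiff ℝ n g)
    (γ : Fin d → ℕ) (i : Fin d) (h : ∑ i, γ i + 1 ≤ n) :
    pderiv1 i (mderiv γ g) = mderiv (γ + Pi.single i 1) g :=
  pderiv1_listDeriv hg γ i _ (List.nodup_finRange d) (List.mem_finRange i)
    (by rwa [sum_map_finRange])

/-- A polynomial centred at `a`, given by its coefficients and exponents. -/
noncomputable def centredPoly {d : ℕ} {ι : Type*} [Fintype ι] (a : Fin d → ℝ) (c : ι → ℝ)
    (e : ι → Fin d → ℕ) : (Fin d → ℝ) → ℝ :=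
  fun y => ∑ α, c α * ∏ j, (y j - a j) ^ e α j

lemma contDiff_centredPoly {d : ℕ} {ι : Type*} [Fintype ι] (a : Fin d → ℝ) (c : ι → ℝ)
    (e : ι → Fin d → ℕ) (n : ℕ) : ContDiff ℝ n (centredPoly a c e) := by
  unfold centredPoly
  refine ContDiff.sum fun α _ => contDiff_const.mul (contDiff_prod fun j _ => ?_)
  exact ((contDiff_apply ℝ ℝ j).sub contDiff_const).pow _

lemma pderiv1_centredPoly {d : ℕ} {ι : Type*} [Fintype ι] (a : Fin d → ℝ) (c : ι → ℝ)
    (e : ι → Fin d → ℕ) (i : Fin d) :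
    pderiv1 i (centredPoly a c e) =
      centredPoly a (fun α => c α * e α i) (fun α => e α - Pi.single i 1) := by
  ext y
  have hfac : ∀ (α : ι) (j : Fin d), HasFDerivAt (fun y : Fin d → ℝ => (y j - a j) ^ e α j)
      ((e α j * (y j - a j) ^ (e α j - 1)) • ContinuousLinearMap.proj (R := ℝ) j) y := by
    intro α j
    have h1 : HasFDerivAt (fun y : Fin d → ℝ => y j - a j)
        (ContinuousLinearMap.proj (R := ℝ) j) y :=
      (hasFDerivAt_apply j y).sub_const (a j)
    simpa using h1.pow (e α j)
  have hsum := HasFDerivAt.fun_sum (u := Finset.univ) fun α _ =>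
    (HasFDerivAt.finsetProd (u := Finset.univ) fun j _ => hfac α j).const_mul (c α)
  rw [pderiv1, HasFDerivAt.fderiv (f := centredPoly a c e) hsum]
  simp only [centredPoly, _root_.sum_apply, _root_.smul_apply,
    ContinuousLinearMap.proj_apply, smul_eq_mul]
  refine Finset.sum_congr rfl fun α _ => ?_
  rw [mul_assoc]
  congr 1
  rw [Finset.sum_eq_single i (fun j _ hj => by simp [Pi.single_eq_of_ne hj]) (by simp),
    ← Finset.mul_prod_erase _ _ (Finset.mem_univ i)]
  have : ∏ j ∈ Finset.univ.erase i, (y j - a j) ^ ((e α - Pi.single i 1 : Fin d → ℕ) j) =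
      ∏ j ∈ Finset.univ.erase i, (y j - a j) ^ e α j :=
    Finset.prod_congr rfl fun j hj => by simp [Pi.single_eq_of_ne (Finset.ne_of_mem_erase hj)]
  rw [this]
  simp
  ring

lemma iterate_pderiv1_centredPoly {d : ℕ} {ι : Type*} [Fintype ι] (a : Fin d → ℝ) (c : ι → ℝ)
    (e : ι → Fin d → ℕ) (i : Fin d) (k : ℕ) :
    (pderiv1 i)^[k] (centredPoly a c e) =
      centredPoly a (fun α => c α * (e α i).descFactorial k)
        (fun α => e α - Pi.single i k) := by
  induction k with
  | zero => simp
  | succ k ih =>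
    rw [Function.iterate_succ_apply', ih, pderiv1_centredPoly]
    congr 1
    · ext α
      simp [Nat.descFactorial_succ]
      ring
    · ext α j
      by_cases hj : j = i
      · subst hj
        simp [Nat.sub_sub]
      · simp [Pi.single_eq_of_ne hj]

lemma listDeriv_centredPoly {d : ℕ} {ι : Type*} [Fintype ι] (a : Fin d → ℝ) (c : ι → ℝ)
    (e : ι → Fin d → ℕ) (γ : Fin d → ℕ) (l : List (Fin d)) (hl : l.Nodup) :
    listDeriv l γ (centredPoly a c e) =
      centredPoly a
        (fun α => c α * ((∏ i ∈ l.toFinset, (e α i).descFactorial (γ i) : ℕ) : ℝ))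
        (fun α j => e α j - if j ∈ l then γ j else 0) := by
  induction l with
  | nil => simp [listDeriv]
  | cons i l ih =>
    rw [List.nodup_cons] at hl
    rw [listDeriv_cons, ih hl.2, iterate_pderiv1_centredPoly]
    congr 1
    · ext α
      rw [List.toFinset_cons, Finset.prod_insert (by simpa using hl.1)]
      simp [hl.1]
      ring
    · ext α j
      by_cases hj : j = i
      · subst hj
        simp [hl.1]
      · simp [hj]

lemma mderiv_centredPoly {d : ℕ} {ι : Type*} [Fintype ι] (a : Fin d → ℝ) (c : ι → ℝ)
    (e : ι → Fin d → ℕ) (γ : Fin d → ℕ) :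
    mderiv γ (centredPoly a c e) =
      centredPoly a (fun α => c α * ((∏ i, (e α i).descFactorial (γ i) : ℕ) : ℝ))
        (fun α => e α - γ) := by
  rw [mderiv_eq_listDeriv, listDeriv_centredPoly a c e γ _ (List.nodup_finRange d)]
  congr 1
  · ext α
    rw [List.toFinset_finRange]
  · ext α j
    simp

/-- The Taylor polynomial of degree `q` of `f` at `a`. -/
noncomputable def taylorPoly {d : ℕ} (q : ℕ) (f : (Fin d → ℝ) → ℝ) (a : Fin d → ℝ) :
    (Fin d → ℝ) → ℝ :=
  centredPoly a
    (fun α : Fin d → Fin (q + 1) => if (∑ i, (α i : ℕ)) ≤ q then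
      mderiv (fun i => (α i : ℕ)) f a / ((∏ i, Nat.factorial (α i : ℕ) : ℕ) : ℝ) else 0)
    (fun α i => (α i : ℕ))

lemma mderiv_taylorPoly {d q : ℕ} (f : (Fin d → ℝ) → ℝ) (a y : Fin d → ℝ) (γ : Fin d → ℕ)
    (hγ : ∑ i, γ i ≤ q) (h : y = a ∨ ∑ i, γ i = q) :
    mderiv γ (taylorPoly q f a) y = mderiv γ f a := by
  have hle : ∀ i, γ i < q + 1 := fun i =>
    Nat.lt_succ_of_le <|
      (Finset.single_le_sum (fun _ _ => Nat.zero_le _) (Finset.mem_univ i)).trans hγ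
  rw [taylorPoly, mderiv_centredPoly, centredPoly,
    Finset.sum_eq_single (fun i => ⟨γ i, hle i⟩)]
  · have hne : ((∏ i, (γ i).factorial : ℕ) : ℝ) ≠ 0 :=
      Nat.cast_ne_zero.2 (Finset.prod_ne_zero_iff.2 fun i _ => Nat.factorial_ne_zero _)
    simp only [Pi.sub_apply, Nat.sub_self, pow_zero, Finset.prod_const_one, mul_one, hγ, if_true,
      Nat.descFactorial_self]
    exact div_mul_cancel₀ _ hne
  · intro α _ hα
    by_cases hlt : ∃ i, (α i : ℕ) < γ i
    · obtain ⟨i, hi⟩ := hlt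
      have : ∏ i, (α i : ℕ).descFactorial (γ i) = 0 :=
        Finset.prod_eq_zero (Finset.mem_univ i) (Nat.descFactorial_eq_zero_iff_lt.2 hi)
      rw [this]
      simp
    push Not at hlt
    obtain ⟨i, hi⟩ : ∃ i, γ i < α i := by
      by_contra! hc
      exact hα (funext fun i => Fin.ext (le_antisymm (hc i) (hlt i)))
    rcases h with rfl | h
    · refine mul_eq_zero_of_right _ (Finset.prod_eq_zero (Finset.mem_univ i) ?_)
      rw [sub_self]
      exact zero_pow (Nat.sub_ne_zero_of_lt hi)
    · have : ∑ i, γ i < ∑ i, (α i : ℕ) :=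
        Finset.sum_lt_sum (fun j _ => hlt j) ⟨i, Finset.mem_univ i, hi⟩
      rw [if_neg (by omega)]
      simp
  · simp

lemma fderiv_eq_sum_pderiv1 {d : ℕ} (g : (Fin d → ℝ) → ℝ) (y h : Fin d → ℝ) :
    fderiv ℝ g y h = ∑ i, h i * pderiv1 i g y := by
  conv_lhs => rw [pi_eq_sum_univ' h, map_sum]
  refine Finset.sum_congr rfl fun i _ => ?_
  rw [map_smul, smul_eq_mul]
  rfl

lemma eucDist_le_sum_abs {d : ℕ} (x y : Fin d → ℝ) : eucDist x y ≤ ∑ i, |x i - y i| := by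
  refine Real.sqrt_le_iff.2 ⟨Finset.sum_nonneg fun _ _ => abs_nonneg _, ?_⟩
  simp only [← sq_abs (x _ - y _)]
  exact Finset.sum_sq_le_sq_sum_of_nonneg fun _ _ => abs_nonneg _

/-- A family of functions closed under partial differentiation and vanishing at `a`, whose
members of top order are `δ`-Hölder at `a`, obeys Taylor-type bounds in all orders. -/
lemma abs_le_of_pderiv1_family {d q : ℕ} {H δ : ℝ} (hH : 0 ≤ H) (hδ : 0 < δ)
    (R : (Fin d → ℕ) → (Fin d → ℝ) → ℝ) {a : Fin d → ℝ} {s : Set (Fin d → ℝ)}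
    (hs : Convex ℝ s) (ha : a ∈ s)
    (hdiff : ∀ γ, ∑ i, γ i + 1 ≤ q → Differentiable ℝ (R γ))
    (hderiv : ∀ γ, ∑ i, γ i + 1 ≤ q → ∀ i, pderiv1 i (R γ) = R (γ + Pi.single i 1))
    (hzero : ∀ γ, ∑ i, γ i ≤ q → R γ a = 0)
    (htop : ∀ γ, ∑ i, γ i = q → ∀ x ∈ s, |R γ x| ≤ H * (∑ i, |x i - a i|) ^ δ)
    (m : ℕ) (γ : Fin d → ℕ) (hm : ∑ i, γ i + m = q) (x : Fin d → ℝ) (hx : x ∈ s) :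
    |R γ x| ≤ H * (∑ i, |x i - a i|) ^ (m + δ) / (m.factorial : ℝ) := by
  induction m generalizing γ x with
  | zero => simpa using htop γ (by simpa using hm) x hx
  | succ m ih =>
    have hγ : ∑ i, γ i + 1 ≤ q := by omega
    set S := ∑ i, |x i - a i| with hS
    have hS0 : 0 ≤ S := Finset.sum_nonneg fun _ _ => abs_nonneg _
    set p : ℝ := m + δ with hp
    have hp0 : 0 < p := by positivity
    set C : ℝ := H * S ^ (p + 1) / ((m + 1).factorial : ℝ) with hC
    have hline : ∀ t : ℝ, HasDerivAt (fun t : ℝ => a + t • (x - a)) (x - a) t := fun t => by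
      simpa using ((hasDerivAt_id t).smul_const (x - a)).const_add a
    have hu : ∀ t : ℝ, HasDerivAt (fun t : ℝ => R γ (a + t • (x - a)))
        (∑ i, (x i - a i) * R (γ + Pi.single i 1) (a + t • (x - a))) t := fun t => by
      have := ((hdiff γ hγ) (a + t • (x - a))).hasFDerivAt.comp_hasDerivAt t (hline t)
      rw [fderiv_eq_sum_pderiv1] at this
      simp only [hderiv γ hγ] at this
      exact this
    have hB : ∀ t : ℝ, HasDerivAt (fun t : ℝ => C * t ^ (p + 1)) (C * ((p + 1) * t ^ p)) t :=
      fun t => by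
        have := (Real.hasDerivAt_rpow_const (x := t) (p := p + 1)
          (Or.inr (by linarith))).const_mul C
        simpa using this
    have hbound : ∀ t ∈ Set.Ico (0 : ℝ) 1,
        ‖∑ i, (x i - a i) * R (γ + Pi.single i 1) (a + t • (x - a))‖ ≤
          C * ((p + 1) * t ^ p) := by
      intro t ht
      have hmem : a + t • (x - a) ∈ s := hs.add_smul_sub_mem ha hx ⟨ht.1, ht.2.le⟩
      have hlen : ∑ i, |(a + t • (x - a)) i - a i| = t * S := by
        simp [hS, Finset.mul_sum, abs_mul, abs_of_nonneg ht.1]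
      have hterm : ∀ i, |R (γ + Pi.single i 1) (a + t • (x - a))| ≤
          H * (t * S) ^ p / (m.factorial : ℝ) := fun i => by
        have := ih (γ + Pi.single i 1) (by simp [Finset.sum_add_distrib]; omega) _ hmem
        rwa [hlen] at this
      calc ‖∑ i, (x i - a i) * R (γ + Pi.single i 1) (a + t • (x - a))‖
          ≤ ∑ i, ‖(x i - a i) * R (γ + Pi.single i 1) (a + t • (x - a))‖ := norm_sum_le _ _
        _ ≤ ∑ i, |x i - a i| * (H * (t * S) ^ p / (m.factorial : ℝ)) := by
            refine Finset.sum_le_sum fun i _ => ?_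
            rw [norm_mul]
            exact mul_le_mul_of_nonneg_left (hterm i) (abs_nonneg _)
        _ = H * S ^ (p + 1) / ((m + 1).factorial : ℝ) * ((m + 1 : ℝ) * t ^ p) := by
            rw [← Finset.sum_mul, ← hS, Real.mul_rpow ht.1 hS0,
              Real.rpow_add_one' hS0 (by positivity), Nat.factorial_succ]
            push_cast
            field_simp
        _ ≤ C * ((p + 1) * t ^ p) := by
            have h0 := ht.1
            have : (m : ℝ) + 1 ≤ p + 1 := by linarith
            gcongr
    have main := image_norm_le_of_norm_deriv_right_le_deriv_boundary
      (f := fun t : ℝ => R γ (a + t • (x - a))) (a := 0) (b := 1)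
      (fun t _ => (hu t).continuousAt.continuousWithinAt)
      (fun t _ => (hu t).hasDerivWithinAt)
      (by
        simp only [zero_smul, add_zero, hzero γ (by omega), norm_zero]
        exact mul_nonneg (by positivity) (Real.rpow_nonneg le_rfl _)) hB hbound
      (Set.right_mem_Icc.2 zero_le_one)
    have hexp : ((m + 1 : ℕ) : ℝ) + δ = p + 1 := by push_cast; ring
    rw [hexp]
    simpa using main

lemma lfloor_lt {β : ℝ} (hβ : 0 < β) : (lfloor β : ℝ) < β := by
  have : 0 < ⌈β⌉₊ := Nat.ceil_pos.2 hβ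
  exact Nat.lt_ceil.1 (by unfold lfloor; omega)

theorem statement11 (β : ℝ) (hβ : 0 < β) (d : ℕ) (hd : 0 < d) (H : ℝ) (hH : 0 < H)
    (f : (Fin d → ℝ) → ℝ) (hf : MemHolderBall1 β H f)
    (a x : Fin d → ℝ) (ha : a ∈ cube d) (hx : x ∈ cube d) :
    ∀ γ : Fin d → ℕ, (∑ i, γ i) ≤ lfloor β →
      |mderiv γ f x -
          mderiv γ (fun y => ∑ α : Fin d → Fin (lfloor β + 1),
            if (∑ i, (α i : ℕ)) ≤ lfloor β then
              (mderiv (fun i => (α i : ℕ)) f a /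
                ((∏ i, Nat.factorial (α i : ℕ) : ℕ) : ℝ)) *
                ∏ i, (y i - a i) ^ (α i : ℕ)
            else 0) x| ≤
        H * ((⨆ i : Fin d, |x i - a i|) * (d : ℝ)) ^ (β - ((∑ i, γ i : ℕ) : ℝ)) /
          ((Nat.factorial (lfloor β - ∑ i, γ i) : ℕ) : ℝ) := by
  intro γ hγ
  obtain ⟨hf, -, hf_holder⟩ := hf
  have hf : ContDiff ℝ (lfloor β) f := by exact_mod_cast hf
  set q := lfloor β with hq
  have hδ : 0 < β - q := sub_pos.2 (lfloor_lt hβ)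
  have hT : (fun y => ∑ α : Fin d → Fin (q + 1),
            if (∑ i, (α i : ℕ)) ≤ q then
              (mderiv (fun i => (α i : ℕ)) f a /
                ((∏ i, Nat.factorial (α i : ℕ) : ℕ) : ℝ)) *
                ∏ i, (y i - a i) ^ (α i : ℕ)
            else 0) = taylorPoly q f a := by
    ext y
    simp only [taylorPoly, centredPoly, ite_mul, zero_mul]
  rw [hT]
  have hTsmooth : ContDiff ℝ q (taylorPoly q f a) := contDiff_centredPoly _ _ _ _
  have hdiff : ∀ {g : (Fin d → ℝ) → ℝ}, ContDiff ℝ q g → ∀ γ : Fin d → ℕ,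
      ∑ i, γ i + 1 ≤ q → Differentiable ℝ (mderiv γ g) := fun hg γ hγ =>
    (hg.mderiv (m := 1) γ (by omega)).differentiable (by norm_num)
  have key := abs_le_of_pderiv1_family hH.le hδ
    (fun γ => mderiv γ f - mderiv γ (taylorPoly q f a)) (convex_Icc 0 1) ha
    (fun γ hγ => (hdiff hf γ hγ).sub (hdiff hTsmooth γ hγ))
    (fun γ hγ i => by
      rw [← pderiv1_mderiv hf γ i hγ, ← pderiv1_mderiv hTsmooth γ i hγ]
      ext y
      simp only [pderiv1, Pi.sub_apply]
      rw [fderiv_sub (hdiff hf γ hγ y) (hdiff hTsmooth γ hγ y)]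
      rfl)
    (fun γ hγ => by simp [mderiv_taylorPoly f a a γ hγ (Or.inl rfl)])
    (fun γ hγ y hy => by
      rw [Pi.sub_apply, mderiv_taylorPoly f a y γ hγ.le (Or.inr hγ)]
      by_cases hya : y = a
      · subst hya
        simp [Real.zero_rpow hδ.ne']
      · refine (hf_holder γ hγ y hy a ha hya).trans ?_
        have h0 : 0 ≤ min 1 (eucDist y a) := le_min zero_le_one (Real.sqrt_nonneg _)
        have h1 := (min_le_right 1 (eucDist y a)).trans (eucDist_le_sum_abs y a)
        gcongr)
    (q - ∑ i, γ i) γ (by omega) x hx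
  refine key.trans ?_
  have hexp : ((q - ∑ i, γ i : ℕ) : ℝ) + (β - q) = β - ((∑ i, γ i : ℕ) : ℝ) := by
    rw [Nat.cast_sub hγ]
    ring
  rw [hexp]
  have hpos : 0 ≤ β - ((∑ i, γ i : ℕ) : ℝ) := by
    rw [← hexp]
    positivity
  have hS : ∑ i, |x i - a i| ≤ (⨆ i : Fin d, |x i - a i|) * (d : ℝ) := by
    calc ∑ i, |x i - a i| ≤ ∑ _i : Fin d, ⨆ i : Fin d, |x i - a i| :=
          Finset.sum_le_sum fun i _ => le_ciSup (Set.finite_range fun i => |x i - a i|).bddAbove i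
      _ = _ := by simp [mul_comm]
  have hS0 : 0 ≤ ∑ i, |x i - a i| := Finset.sum_nonneg fun _ _ => abs_nonneg _
  gcongr
end
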